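/- Let n ≥ 2 and G ≤ S_n. If V_n(G) is isomorphic to V_n as abstract groups, then G is semiregular. -/

import Mathlib

open scoped Classical Pointwise

/-- The group of self-homeomorphisms of a topological space, with
`(f * g) x = f (g x)`. -/
instance homeoGroup (X : Type*) [TopologicalSpace X] : Group (X ≃ₜ X) where
  mul a b := b.trans a
  one := Homeomorph.refl X
  inv := Homeomorph.symm
  mul_assoc a b c := Homeomorph.ext fun _ => rfl
  one_mul a := Homeomorph.ext fun _ => rfl
  mul_one a := Homeomorph.ext fun _ => rfl
  inv_mul_cancel a := Homeomorph.ext fun x => a.symm_apply_apply x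

/-- The `n`-ary Cantor space: infinite sequences over an `n`-letter alphabet. -/
abbrev Cantor (n : ℕ) := ℕ → Fin n

/-- Prefix a sequence by a finite word. -/
def appendWord {n : ℕ} (θ : List (Fin n)) (x : Cantor n) : Cantor n :=
  fun i => if h : i < θ.length then θ.get ⟨i, h⟩ else x (i - θ.length)

/-- `x` lies in the cone `[θ]`, i.e. has `θ` as a prefix. -/
def inCone {n : ℕ} (θ : List (Fin n)) (x : Cantor n) : Prop :=
  ∀ i, (h : i < θ.length) → x i = θ.get ⟨i, h⟩

/-- A map is a prefix-substitution map if it is given by two partitions of the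
Cantor space into cones `[α i]` resp. `[β i]`, replacing the prefix `α i` by `β i`. -/
def IsPrefixMap {n : ℕ} (v : Cantor n → Cantor n) : Prop :=
  ∃ (t : ℕ) (α β : Fin t → List (Fin n)),
    (∀ x : Cantor n, ∃! i, inCone (α i) x) ∧
    (∀ x : Cantor n, ∃! i, inCone (β i) x) ∧
    ∀ (i : Fin t) (γ : Cantor n), v (appendWord (α i) γ) = appendWord (β i) γ

/-- The Higman–Thompson group `V_n`, as a subgroup of the homeomorphism group of
the `n`-ary Cantor space: the group of all prefix-substitution homeomorphisms. -/
def HigmanThompson (n : ℕ) : Subgroup (Cantor n ≃ₜ Cantor n) :=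
  Subgroup.closure {v | IsPrefixMap ⇑v}

/-- The iterated permutation `[α]_g` (as a function): identity outside the cone
`[α]`, and applying `g` to every letter after the prefix `α` inside it.
With `α = []` this is `[∅]_g`, applying `g` to every letter. -/
noncomputable def iterPermFun {n : ℕ} (α : List (Fin n)) (g : Equiv.Perm (Fin n))
    (x : Cantor n) : Cantor n :=
  if inCone α x then fun i => if i < α.length then x i else g (x i) else x

/-- The group `V_n(G)`: the subgroup of the homeomorphism group of the `n`-ary
Cantor space generated by `V_n` together with all iterated permutations `[α]_g`
for `g ∈ G` and finite words `α`. -/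
def VnG (n : ℕ) (G : Subgroup (Equiv.Perm (Fin n))) : Subgroup (Cantor n ≃ₜ Cantor n) :=
  Subgroup.closure
    ({v | IsPrefixMap ⇑v} ∪
      {v | ∃ (α : List (Fin n)) (g : Equiv.Perm (Fin n)), g ∈ G ∧ ⇑v = iterPermFun α g})

/-- A permutation group is semiregular if no nontrivial element has a fixed point. -/
def Semiregular {n : ℕ} (G : Subgroup (Equiv.Perm (Fin n))) : Prop :=
  ∀ g ∈ G, (∃ x, g x = x) → g = 1

open scoped commutatorElement

section Abstract

/-- Algebraic disjointness (after Rubin). -/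
def AlgDisj {Γ : Type*} [Group Γ] (f g : Γ) : Prop :=
  ∀ h : Γ, f * h ≠ h * f → ∃ f1 f2 : Γ, Commute f1 g ∧ Commute f2 g ∧
    Commute ⁅f1, ⁅f2, h⁆⁆ g ∧ ⁅f1, ⁅f2, h⁆⁆ ≠ 1

theorem AlgDisj.map {Γ Δ : Type*} [Group Γ] [Group Δ] (e : Γ ≃* Δ) {f g : Γ}
    (H : AlgDisj f g) : AlgDisj (e f) (e g) := by
  intro h hh
  obtain ⟨f1, f2, h1, h2, h3, h4⟩ := H (e.symm h) (by
    intro h'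
    apply hh
    have := congrArg e h'
    simpa using this)
  have key : e ⁅f1, ⁅f2, e.symm h⁆⁆ = ⁅e f1, ⁅e f2, h⁆⁆ := by
    simp [map_commutatorElement]
  refine ⟨e f1, e f2, h1.map e, h2.map e, ?_, ?_⟩
  · rw [← key]; exact h3.map e
  · rw [← key]; exact (map_ne_one_iff e e.injective).2 h4

/-- The distinguishing group-theoretic property. -/
def GoodGroup (Γ : Type*) [Group Γ] : Prop :=
  ∀ u : Γ, IsOfFinOrder u → ∃ S : Set Γ, S.Finite ∧
    (∀ s ∈ S, AlgDisj s (u * s * u⁻¹) ∨ AlgDisj u s) ∧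
    ∀ h : Γ, (∀ s ∈ S, AlgDisj h (s ^ 12)) → h = 1

theorem GoodGroup.map {Γ Δ : Type*} [Group Γ] [Group Δ] (e : Γ ≃* Δ)
    (H : GoodGroup Γ) : GoodGroup Δ := by
  intro u hu
  obtain ⟨S, hS, h1, h2⟩ := H (e.symm u) (by
    exact (MonoidHom.isOfFinOrder e.symm.toMonoidHom hu))
  refine ⟨e '' S, hS.image e, ?_, ?_⟩
  · rintro _ ⟨s, hs, rfl⟩
    rcases h1 s hs with h | h
    · left
      have := h.map e
      simpa using this
    · right
      have := h.map e
      simpa using this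
  · intro h hh
    have := h2 (e.symm h) (by
      intro s hs
      have := (hh (e s) ⟨s, hs, rfl⟩).map e.symm
      simpa using this)
    simpa using this

variable {X : Type*} [TopologicalSpace X] [T2Space X] {Γ : Type*} [Group Γ] [MulAction Γ X]
  [FaithfulSMul Γ X] [ContinuousConstSMul Γ X]

/-- Rigid stabilizers of nonempty open sets are nonabelian. -/
def Rich (X Γ : Type*) [TopologicalSpace X] [Group Γ] [MulAction Γ X] : Prop :=
  ∀ U : Set X, IsOpen U → U.Nonempty → ∃ a b : Γ, (∀ y, y ∉ U → a • y = y) ∧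
    (∀ y, y ∉ U → b • y = y) ∧ a * b ≠ b * a

theorem commute_of_disj {a b : Γ} (h : ∀ y : X, a • y = y ∨ b • y = y) : Commute a b := by
  refine FaithfulSMul.eq_of_smul_eq_smul (α := X) fun y => ?_
  rw [mul_smul, mul_smul]
  by_cases ha : a • y = y
  · rw [ha]
    rcases h (b • y) with h1 | h1
    · exact h1
    · have : b • y = y := smul_left_cancel b h1
      rw [this, ha]
  · have hb : b • y = y := (h y).resolve_left ha
    rw [hb]
    rcases h (a • y) with h1 | h1
    · exact absurd (smul_left_cancel a h1) ha
    · exact h1.symm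

theorem exists_moved_nhd (q : Γ) (x : X) (hq : q • x ≠ x) :
    ∃ U : Set X, IsOpen U ∧ x ∈ U ∧ ∀ y ∈ U, q • y ∉ U := by
  obtain ⟨A, B, hA, hB, hxA, hxB, hAB⟩ := t2_separation hq
  refine ⟨B ∩ (fun y => q • y) ⁻¹' A, hB.inter (hA.preimage (continuous_const_smul q)),
    ⟨hxB, hxA⟩, ?_⟩
  rintro y ⟨_, hy⟩ ⟨hy2, _⟩
  exact Set.disjoint_left.1 hAB hy hy2

theorem algDisj_of_disj (hR : Rich X Γ) {f g : Γ} (hd : ∀ y : X, f • y = y ∨ g • y = y) :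
    AlgDisj f g := by
  intro h hh
  have hz : ∃ z : X, f • z ≠ z ∧ h • z ≠ z := by
    by_contra hcon
    push Not at hcon
    apply hh
    exact commute_of_disj (X := X) fun y => by
      by_cases hy : f • y = y
      · exact Or.inl hy
      · exact Or.inr (hcon y hy)
  obtain ⟨z, hfz, hhz⟩ := hz
  obtain ⟨U, hU, hzU, hUh⟩ := exists_moved_nhd h z hhz
  have hV : IsOpen (U ∩ {y : X | f • y ≠ y}) :=
    hU.inter (isOpen_ne_fun (continuous_const_smul f) continuous_id)
  obtain ⟨a, b, ha, hb, hab⟩ := hR _ hV ⟨z, hzU, hfz⟩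
  have hag : Commute a g := commute_of_disj (X := X) fun y => by
    by_cases hy : y ∈ U ∩ {y : X | f • y ≠ y}
    · exact Or.inr ((hd y).resolve_left hy.2)
    · exact Or.inl (ha y hy)
  have hbg : Commute b g := commute_of_disj (X := X) fun y => by
    by_cases hy : y ∈ U ∩ {y : X | f • y ≠ y}
    · exact Or.inr ((hd y).resolve_left hy.2)
    · exact Or.inl (hb y hy)
  have hac : Commute a (h * b⁻¹ * h⁻¹) := commute_of_disj (X := X) fun y => by
    by_cases hy : y ∈ U ∩ {y : X | f • y ≠ y}
    · right
      have h1 : h⁻¹ • y ∉ U ∩ {y : X | f • y ≠ y} := by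
        intro h2
        have := hUh _ h2.1
        rw [smul_inv_smul] at this
        exact this hy.1
      have h2 := hb _ h1
      rw [mul_smul, mul_smul, inv_smul_eq_iff.2 h2.symm, smul_inv_smul]
    · exact Or.inl (ha y hy)
  have key : ⁅a, ⁅b, h⁆⁆ = ⁅a, b⁆ := by
    have e1 : ⁅b, h⁆ = b * (h * b⁻¹ * h⁻¹) := by rw [commutatorElement_def]; group
    rw [e1, commutatorElement_def, commutatorElement_def, mul_inv_rev]
    have e2 := hac.inv_left.eq
    generalize h * b⁻¹ * h⁻¹ = c at *
    calc a * (b * c) * a⁻¹ * (c⁻¹ * b⁻¹) = a * b * (c * a⁻¹) * c⁻¹ * b⁻¹ := by group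
      _ = a * b * (a⁻¹ * c) * c⁻¹ * b⁻¹ := by rw [e2]
      _ = _ := by group
  refine ⟨a, b, hag, hbg, ?_, ?_⟩
  · rw [key, commutatorElement_def]
    exact ((hag.mul_left hbg).mul_left hag.inv_left).mul_left hbg.inv_left
  · rw [key]
    intro h1
    exact hab (commutatorElement_eq_one_iff_mul_comm.1 h1)

theorem disj_of_algDisj (hR : Rich X Γ) {f g : Γ} (hd : AlgDisj f g) (x : X) :
    f • x = x ∨ g ^ 12 • x = x := by
  by_contra hcon
  push Not at hcon
  obtain ⟨hf, hg⟩ := hcon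
  have hgd : ∀ d : ℕ, d ∣ 12 → g ^ d • x ≠ x := by
    rintro d ⟨e, he⟩ hx
    apply hg
    rw [he, pow_mul]
    have : ∀ e : ℕ, (g ^ d) ^ e • x = x := by
      intro e
      induction e with
      | zero => simp
      | succ e ih => rw [pow_succ, mul_smul, hx, ih]
    exact this e
  obtain ⟨U0, o0, x0, m0⟩ := exists_moved_nhd f x hf
  obtain ⟨U1, o1, x1, m1⟩ := exists_moved_nhd (g ^ 1) x (hgd 1 (by norm_num))
  obtain ⟨U2, o2, x2, m2⟩ := exists_moved_nhd (g ^ 2) x (hgd 2 (by norm_num))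
  obtain ⟨U3, o3, x3, m3⟩ := exists_moved_nhd (g ^ 3) x (hgd 3 (by norm_num))
  obtain ⟨U4, o4, x4, m4⟩ := exists_moved_nhd (g ^ 4) x (hgd 4 (by norm_num))
  obtain ⟨U, hUo, hxU, hUf, hUg⟩ : ∃ U : Set X, IsOpen U ∧ x ∈ U ∧ (∀ y ∈ U, f • y ∉ U) ∧
      ∀ d : ℕ, 0 < d → d ≤ 4 → ∀ y ∈ U, g ^ d • y ∉ U := by
    refine ⟨U0 ∩ U1 ∩ U2 ∩ U3 ∩ U4, (((o0.inter o1).inter o2).inter o3).inter o4,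
      ⟨⟨⟨⟨x0, x1⟩, x2⟩, x3⟩, x4⟩, fun y hy hy' => m0 y hy.1.1.1.1 hy'.1.1.1.1, ?_⟩
    intro d hd0 hd4 y hy hy'
    interval_cases d
    · exact m1 y hy.1.1.1.2 hy'.1.1.1.2
    · exact m2 y hy.1.1.2 hy'.1.1.2
    · exact m3 y hy.1.2 hy'.1.2
    · exact m4 y hy.2 hy'.2
  obtain ⟨h, b, hh, -, hhb⟩ := hR U hUo ⟨x, hxU⟩
  have hh1 : ∃ z : X, h • z ≠ z := by
    by_contra hc
    push Not at hc
    apply hhb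
    exact commute_of_disj (X := X) fun y => Or.inl (hc y)
  obtain ⟨z, hz⟩ := hh1
  have hzU : z ∈ U := by
    by_contra hc
    exact hz (hh z hc)
  obtain ⟨f1, f2, c1, c2, cm, mne⟩ := hd h (by
    intro hcomm
    have h1 : (f * h) • z = (h * f) • z := by rw [hcomm]
    rw [mul_smul, mul_smul, hh _ (hUf z hzU)] at h1
    exact hz (smul_left_cancel f h1))
  have hm : ∃ w : X, ⁅f1, ⁅f2, h⁆⁆ • w ≠ w := by
    by_contra hc
    push Not at hc
    apply mne
    exact FaithfulSMul.eq_of_smul_eq_smul (α := X) fun y => by rw [hc y, one_smul]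
  obtain ⟨w, hw⟩ := hm
  have key : ⁅f1, ⁅f2, h⁆⁆ = ((f1 * f2) * h * (f1 * f2)⁻¹) * (f1 * h⁻¹ * f1⁻¹) * (1 * h * 1⁻¹)
      * (f2 * h⁻¹ * f2⁻¹) := by
    simp only [commutatorElement_def]; group
  have hconj : ∀ (q : Γ) (y : X), q⁻¹ • y ∉ U → (q * h * q⁻¹) • y = y := by
    intro q y hy
    rw [mul_smul, mul_smul, hh _ hy, smul_inv_smul]
  have hconj' : ∀ (q : Γ) (y : X), q⁻¹ • y ∉ U → (q * h⁻¹ * q⁻¹) • y = y := by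
    intro q y hy
    rw [mul_smul, mul_smul, inv_smul_eq_iff.2 (hh _ hy).symm, smul_inv_smul]
  let Q : Fin 4 → Γ := ![f1 * f2, f1, 1, f2]
  have hQ : ∀ j, Commute (Q j) g := by
    intro j
    fin_cases j
    · exact c1.mul_left c2
    · exact c1
    · exact Commute.one_left g
    · exact c2
  have hcov : ∀ y : X, ⁅f1, ⁅f2, h⁆⁆ • y ≠ y → ∃ j, (Q j)⁻¹ • y ∈ U := by
    intro y hy
    by_contra hc
    push Not at hc
    apply hy
    have q0 : (f1 * f2)⁻¹ • y ∉ U := hc 0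
    have q1 : f1⁻¹ • y ∉ U := hc 1
    have q2 : (1 : Γ)⁻¹ • y ∉ U := hc 2
    have q3 : f2⁻¹ • y ∉ U := hc 3
    rw [key, mul_smul, hconj' _ _ q3, mul_smul, hconj _ _ q2, mul_smul, hconj' _ _ q1,
      hconj _ _ q0]
  have horb : ∀ i : Fin 5, ∃ j, (Q j)⁻¹ • (g ^ (i : ℕ) • w) ∈ U := by
    intro i
    apply hcov
    intro h1
    apply hw
    rw [← mul_smul, (cm.pow_right (i : ℕ)).eq, mul_smul] at h1
    exact smul_left_cancel _ h1
  choose J hJ using horb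
  obtain ⟨i, i', hne, hii⟩ := Fintype.exists_ne_map_eq_of_card_lt J (by simp)
  have fin : ∀ i i' : Fin 5, i < i' → J i = J i' → False := by
    intro i i' hlt hii
    have h1 := hJ i
    have h2 := hJ i'
    rw [← hii] at h2
    have hlt' : (i : ℕ) < i' := hlt
    refine hUg ((i' : ℕ) - i) (by omega) (by omega) _ h1 ?_
    have e : (i' : ℕ) = (i' - i) + i := by omega
    rw [e, pow_add, mul_smul, ← mul_smul, ((hQ (J i)).inv_left.pow_right _).eq, mul_smul] at h2
    exact h2
  rcases lt_or_gt_of_ne hne with hlt | hlt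
  · exact fin i i' hlt hii
  · exact fin i' i hlt hii.symm

end Abstract

section Concrete

instance homeoAct (X : Type*) [TopologicalSpace X] : MulAction (X ≃ₜ X) X where
  smul f x := f x
  one_smul _ := rfl
  mul_smul _ _ _ := rfl

theorem homeo_sub_smul {X : Type*} [TopologicalSpace X] (H : Subgroup (X ≃ₜ X)) (f : H) (x : X) :
    f • x = (f : X ≃ₜ X) x := rfl

instance homeoFaithful (X : Type*) [TopologicalSpace X] (H : Subgroup (X ≃ₜ X)) :
    FaithfulSMul H X where
  eq_of_smul_eq_smul h := Subtype.ext (Homeomorph.ext h)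

instance homeoCont (X : Type*) [TopologicalSpace X] (H : Subgroup (X ≃ₜ X)) :
    ContinuousConstSMul H X where
  continuous_const_smul f := (f : X ≃ₜ X).continuous

variable {n : ℕ}

/-- Permute the prefixes of length `N`. -/
def permFun (N : ℕ) (τ : Equiv.Perm (Fin N → Fin n)) (x : Cantor n) : Cantor n :=
  fun i => if h : i < N then τ (fun j => x j) ⟨i, h⟩ else x i

theorem permFun_prefix (N : ℕ) (τ : Equiv.Perm (Fin N → Fin n)) (x : Cantor n) :
    (fun j : Fin N => permFun N τ x j) = τ (fun j => x j) := by
  funext j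
  simp [permFun]

theorem permFun_comp (N : ℕ) (τ σ : Equiv.Perm (Fin N → Fin n)) (x : Cantor n) :
    permFun N τ (permFun N σ x) = permFun N (τ * σ) x := by
  funext i
  by_cases h : i < N
  · have := permFun_prefix N σ x
    have e : permFun N τ (permFun N σ x) i = τ (fun j => permFun N σ x j) ⟨i, h⟩ := by
      rw [permFun, dif_pos h]
    rw [e, this]
    simp [permFun, h]
  · simp [permFun, h]

theorem permFun_one (N : ℕ) (x : Cantor n) : permFun N 1 x = x := by
  funext i
  simp [permFun]

theorem permFun_continuous (N : ℕ) (τ : Equiv.Perm (Fin N → Fin n)) :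
    Continuous (permFun N τ) := by
  refine continuous_pi fun i => ?_
  by_cases h : i < N
  · simp only [permFun, h, dif_pos]
    have h1 : Continuous (fun x : Cantor n => (fun j : Fin N => x j)) := by fun_prop
    have h2 : Continuous (fun v : Fin N → Fin n => τ v ⟨i, h⟩) := continuous_of_discreteTopology
    exact h2.comp h1
  · simp only [permFun, h, dif_neg, not_false_eq_true]
    fun_prop

/-- The corresponding homeomorphism. -/
def permHomeo (N : ℕ) (τ : Equiv.Perm (Fin N → Fin n)) : Cantor n ≃ₜ Cantor n where
  toFun := permFun N τ
  invFun := permFun N τ⁻¹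
  left_inv x := by rw [permFun_comp]; simp [permFun_one]
  right_inv x := by rw [permFun_comp]; simp [permFun_one]
  continuous_toFun := permFun_continuous N τ
  continuous_invFun := permFun_continuous N τ⁻¹

theorem inCone_ofFn (N : ℕ) (v : Fin N → Fin n) (x : Cantor n) :
    inCone (List.ofFn v) x ↔ (fun j : Fin N => x j) = v := by
  constructor
  · intro h
    funext j
    have := h j (by simp)
    simpa using this
  · rintro rfl i hi
    simp

theorem permHomeo_isPrefix (N : ℕ) (τ : Equiv.Perm (Fin N → Fin n)) :
    IsPrefixMap (permHomeo N τ) := by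
  let e := Fintype.equivFin (Fin N → Fin n)
  refine ⟨_, fun i => List.ofFn (e.symm i), fun i => List.ofFn (τ (e.symm i)), ?_, ?_, ?_⟩
  · intro x
    refine ⟨e (fun j => x j), ?_, ?_⟩
    · simp [inCone_ofFn]
    · intro i hi
      simp only [inCone_ofFn] at hi
      rw [hi]; simp
  · intro x
    refine ⟨e (τ⁻¹ (fun j => x j)), ?_, ?_⟩
    · simp [inCone_ofFn]
    · intro i hi
      simp only [inCone_ofFn] at hi
      rw [hi]; simp
  · intro i γ
    have h0 : (fun j : Fin N => appendWord (List.ofFn (e.symm i)) γ j) = e.symm i := by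
      funext j
      simp [appendWord]
    funext j
    change permFun N τ _ j = _
    by_cases h : j < N
    · simp only [permFun, h, dif_pos, h0]
      simp [appendWord, h]
    · simp [permFun, appendWord, h]

/-- The words of length `M + 8` extending `x|M`. -/
noncomputable def extWords (x : Cantor n) (M : ℕ) : Finset (Fin (M + 8) → Fin n) :=
  Finset.univ.filter fun v => ∀ i : Fin (M + 8), (i : ℕ) < M → v i = x i

theorem extWords_card (hn : 2 ≤ n) (x : Cantor n) (M : ℕ) : 256 ≤ (extWords x M).card := by
  have h1 : (Finset.univ : Finset (Fin 8 → Fin n)).card ≤ (extWords x M).card := by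
    apply Finset.card_le_card_of_injOn
      (fun (v : Fin 8 → Fin n) (i : Fin (M + 8)) =>
        if h : (i : ℕ) < M then x i else v ⟨i - M, by omega⟩)
    · intro v _
      simp only [extWords, Finset.coe_filter, Finset.mem_univ, true_and, Set.mem_setOf_eq]
      intro i hi
      simp [hi]
    · intro v _ w _ hvw
      funext j
      have := congrFun hvw ⟨M + j, by omega⟩
      simpa using this
  have h2 : 2 ^ 8 ≤ n ^ 8 := Nat.pow_le_pow_left hn 8
  simp at h1
  omega

theorem mem_extWords (x y : Cantor n) (M : ℕ) :
    (fun j : Fin (M + 8) => y j) ∈ extWords x M ↔ ∀ i < M, y i = x i := by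
  simp only [extWords, Finset.mem_filter, Finset.mem_univ, true_and]
  constructor
  · intro h i hi
    exact h ⟨i, by omega⟩ hi
  · intro h i hi
    exact h i hi

theorem permFun_fix (N : ℕ) (τ : Equiv.Perm (Fin N → Fin n)) (x : Cantor n) :
    permFun N τ x = x ↔ τ (fun j => x j) = (fun j : Fin N => x j) := by
  constructor
  · intro h
    rw [← permFun_prefix, h]
  · intro h
    funext i
    by_cases hi : i < N
    · simp [permFun, hi, h]
    · simp [permFun, hi]

theorem exists_cone {U : Set (Cantor n)} (hU : IsOpen U) {x : Cantor n} (hx : x ∈ U) :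
    ∃ M : ℕ, ∀ y : Cantor n, (∀ i < M, y i = x i) → y ∈ U := by
  obtain ⟨I, u, h1, h2⟩ := isOpen_pi_iff.1 hU x hx
  refine ⟨I.sup id + 1, fun y hy => h2 ?_⟩
  intro i hi
  have : i ≤ I.sup id := Finset.le_sup (f := id) hi
  rw [hy i (by omega)]
  exact (h1 i hi).2

theorem isOpen_cone (x : Cantor n) (M : ℕ) : IsOpen {y : Cantor n | ∀ i < M, y i = x i} := by
  have : {y : Cantor n | ∀ i < M, y i = x i} = ⋂ i ∈ Finset.range M, {y | y i = x i} := by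
    ext y; simp
  rw [this]
  refine isOpen_biInter_finset fun i _ => ?_
  exact (isOpen_discrete ({x i} : Set (Fin n))).preimage
    (continuous_apply (A := fun _ : ℕ => Fin n) i)

theorem rich_of_le (hn : 2 ≤ n) (H : Subgroup (Cantor n ≃ₜ Cantor n))
    (hH : HigmanThompson n ≤ H) : Rich (Cantor n) H := by
  rintro U hU ⟨x, hx⟩
  obtain ⟨M, hM⟩ := exists_cone hU hx
  have hc := extWords_card hn x M
  obtain ⟨a, ha, b, hb, c, hc, hab, hac, hbc⟩ := Finset.two_lt_card.1
    (show 2 < (extWords x M).card by omega)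
  have hmem : ∀ τ : Equiv.Perm (Fin (M + 8) → Fin n), permHomeo (M + 8) τ ∈ H :=
    fun τ => hH (Subgroup.subset_closure (permHomeo_isPrefix _ τ))
  have hfix : ∀ a ∈ extWords x M, ∀ b ∈ extWords x M, ∀ y : Cantor n, y ∉ U →
      permFun (M + 8) (Equiv.swap a b) y = y := by
    intro a ha b hb y hy
    have hy' : (fun j : Fin (M + 8) => y j) ∉ extWords x M := by
      rw [mem_extWords]
      exact fun h => hy (hM y h)
    rw [permFun_fix]
    apply Equiv.swap_apply_of_ne_of_ne
    · rintro rfl; exact hy' ha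
    · rintro rfl; exact hy' hb
  refine ⟨⟨_, hmem (Equiv.swap a b)⟩, ⟨_, hmem (Equiv.swap b c)⟩, hfix a ha b hb, hfix b hb c hc,
    ?_⟩
  intro h
  let y : Cantor n := fun i => if hi : i < M + 8 then a ⟨i, hi⟩ else x i
  have hy : (fun j : Fin (M + 8) => y j) = a := by
    funext j
    simp [y]
  have h1 : permFun (M + 8) (Equiv.swap a b) (permFun (M + 8) (Equiv.swap b c) y) =
      permFun (M + 8) (Equiv.swap b c) (permFun (M + 8) (Equiv.swap a b) y) :=
    congrArg (fun f : H => (f : Cantor n ≃ₜ Cantor n) y) h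
  have h2 := congrArg (fun z : Cantor n => (fun j : Fin (M + 8) => z j)) h1
  simp only [permFun_prefix, hy] at h2
  rw [Equiv.swap_apply_of_ne_of_ne hab hac, Equiv.swap_apply_left, Equiv.swap_apply_left] at h2
  exact hbc h2

theorem exists_rot (hn : 2 ≤ n) (x : Cantor n) (M : ℕ) :
    ∃ s : HigmanThompson n, (∀ y : Cantor n, (¬ ∀ i < M, y i = x i) → s • y = y) ∧
      ∀ y : Cantor n, (∀ i < M, y i = x i) → (s ^ 12) ^ 12 • y ≠ y := by
  obtain ⟨τ, hτ, hs⟩ := (extWords x M).exists_cycleOn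
  have hpow : ∀ (m : ℕ) (y : Cantor n),
      ((⟨permHomeo (M + 8) τ, Subgroup.subset_closure (permHomeo_isPrefix _ τ)⟩ :
        HigmanThompson n) ^ m) • y = permFun (M + 8) (τ ^ m) y := by
    intro m y
    induction m with
    | zero => simp [permFun_one]
    | succ m ih =>
      rw [pow_succ', pow_succ', mul_smul, ih, ← permFun_comp]
      rfl
  refine ⟨⟨permHomeo (M + 8) τ, Subgroup.subset_closure (permHomeo_isPrefix _ τ)⟩, ?_, ?_⟩
  · intro y hy
    have := hpow 1 y
    rw [pow_one, pow_one] at this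
    rw [this, permFun_fix]
    rw [← mem_extWords] at hy
    by_contra hc
    exact hy (hs (Equiv.Perm.mem_support.2 hc))
  · intro y hy
    rw [← pow_mul, hpow, Ne, permFun_fix]
    rw [← mem_extWords] at hy
    rw [hτ.pow_apply_eq hy]
    intro hd
    have := Nat.le_of_dvd (by norm_num) hd
    have := extWords_card hn x M
    omega

/-- Local normal form of `v` at `x`. -/
def LocAt (v : Cantor n → Cantor n) (x : Cantor n) (k l : ℕ) (g : Equiv.Perm (Fin n)) : Prop :=
  ∀ y : Cantor n, (∀ i < k, y i = x i) →
    (∀ j < l, v y j = v x j) ∧ ∀ i, v y (l + i) = g (y (k + i))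

theorem LocAt.comp {u v : Cantor n → Cantor n} {x : Cantor n} {k l k' l' : ℕ}
    {g g' : Equiv.Perm (Fin n)} (hv : LocAt v x k l g) (hu : LocAt u (v x) k' l' g') :
    LocAt (u ∘ v) x (k + k') (l + l') (g' * g) := by
  intro y hy
  obtain ⟨h1, h2⟩ := hv y (fun i hi => hy i (by omega))
  have h3 := (hv x (fun _ _ => rfl)).2
  have hpre : ∀ j < l + k', v y j = v x j := by
    intro j hj
    by_cases hjl : j < l
    · exact h1 j hjl
    · obtain ⟨i, rfl⟩ : ∃ i, j = l + i := ⟨j - l, by omega⟩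
      rw [h2, h3, hy _ (by omega)]
  obtain ⟨h4, h5⟩ := hu (v y) (fun i hi => hpre i (by omega))
  have h6 := (hu (v x) (fun _ _ => rfl)).2
  constructor
  · intro j hj
    by_cases hjl : j < l'
    · exact h4 j hjl
    · obtain ⟨i, rfl⟩ : ∃ i, j = l' + i := ⟨j - l', by omega⟩
      simp only [Function.comp]
      rw [h5, h6, hpre _ (by omega)]
  · intro i
    simp only [Function.comp]
    rw [show l + l' + i = l' + (l + i) by omega, h5,
      show k' + (l + i) = l + (k' + i) by omega, h2, add_assoc]
    rfl

theorem LocAt.symm {v : Cantor n ≃ₜ Cantor n} {x : Cantor n} {k l : ℕ}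
    {g : Equiv.Perm (Fin n)} (hv : LocAt v x k l g) :
    LocAt v.symm (v x) l k g⁻¹ := by
  intro y hy
  let z : Cantor n := fun i => if i < k then x i else g⁻¹ (y (l + (i - k)))
  have hz : ∀ i < k, z i = x i := fun i hi => by simp [z, hi]
  obtain ⟨h1, h2⟩ := hv z hz
  have hvz : v z = y := by
    funext j
    by_cases hjl : j < l
    · rw [h1 j hjl, hy j hjl]
    · obtain ⟨i, rfl⟩ : ∃ i, j = l + i := ⟨j - l, by omega⟩
      rw [h2]
      simp [z]
  rw [← hvz]
  simp only [Homeomorph.symm_apply_apply]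
  refine ⟨hz, fun i => ?_⟩
  rw [h2]; simp

theorem append_of_inCone {α : List (Fin n)} {x : Cantor n} (h : inCone α x) :
    appendWord α (fun i => x (α.length + i)) = x := by
  funext i
  by_cases hi : i < α.length
  · simp only [appendWord, hi, dif_pos]
    exact (h i hi).symm
  · simp only [appendWord, hi, dif_neg, not_false_eq_true]
    congr 1; omega

theorem locAt_prefix {v : Cantor n → Cantor n} (hv : IsPrefixMap v) (x : Cantor n) :
    ∃ k l, LocAt v x k l 1 := by
  obtain ⟨t, α, β, hα, -, h⟩ := hv
  obtain ⟨i, hi, -⟩ := hα x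
  have hx := append_of_inCone hi
  refine ⟨(α i).length, (β i).length, fun y hy => ?_⟩
  have hiy : inCone (α i) y := fun j hj => by rw [hy j hj]; exact hi j hj
  have hyy := append_of_inCone hiy
  rw [← hx, ← hyy, h, h]
  constructor
  · intro j hj
    simp [appendWord, hj]
  · intro j
    simp [appendWord]

theorem locAt_iter (α : List (Fin n)) (g : Equiv.Perm (Fin n)) (x : Cantor n) :
    ∃ k l, LocAt (iterPermFun α g) x k l g ∨ LocAt (iterPermFun α g) x k l 1 := by
  refine ⟨α.length, α.length, ?_⟩
  by_cases h : inCone α x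
  · left
    intro y hy
    have hiy : inCone α y := fun j hj => by rw [hy j hj]; exact h j hj
    simp only [iterPermFun, h, hiy, if_true]
    constructor
    · intro j hj
      simp [hj, hy j hj]
    · intro j
      simp
  · right
    intro y hy
    have hiy : ¬ inCone α y := fun h' => h fun j hj => by rw [← hy j hj]; exact h' j hj
    simp only [iterPermFun, h, hiy, if_false]
    exact ⟨hy, fun i => rfl⟩

theorem locAt_ht {v : Cantor n ≃ₜ Cantor n} (hv : v ∈ HigmanThompson n) :
    ∀ x, ∃ k l, LocAt v x k l 1 := by
  induction hv using Subgroup.closure_induction with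
  | mem v hv => exact locAt_prefix hv
  | one => exact fun x => ⟨0, 0, fun y _ => ⟨by simp, fun i => rfl⟩⟩
  | mul u v _ _ hu hv =>
    intro x
    obtain ⟨k, l, h⟩ := hv x
    obtain ⟨k', l', h'⟩ := hu (v x)
    exact ⟨_, _, h.comp h'⟩
  | inv v _ hv =>
    intro x
    obtain ⟨k, l, h⟩ := hv (v.symm x)
    have := h.symm
    rw [Homeomorph.apply_symm_apply] at this
    exact ⟨_, _, this⟩

theorem locAt_vnG {G : Subgroup (Equiv.Perm (Fin n))} {v : Cantor n ≃ₜ Cantor n}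
    (hv : v ∈ VnG n G) : ∀ x, ∃ k l g, LocAt v x k l g := by
  induction hv using Subgroup.closure_induction with
  | mem v hv =>
    intro x
    rcases hv with hv | ⟨α, g, -, hv⟩
    · obtain ⟨k, l, h⟩ := locAt_prefix hv x
      exact ⟨k, l, _, h⟩
    · obtain ⟨k, l, h⟩ := locAt_iter α g x
      rw [← hv] at h
      rcases h with h | h
      · exact ⟨k, l, _, h⟩
      · exact ⟨k, l, _, h⟩
  | one => exact fun x => ⟨0, 0, 1, fun y _ => ⟨by simp, fun i => rfl⟩⟩
  | mul u v _ _ hu hv =>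
    intro x
    obtain ⟨k, l, g, h⟩ := hv x
    obtain ⟨k', l', g', h'⟩ := hu (v x)
    exact ⟨_, _, _, h.comp h'⟩
  | inv v _ hv =>
    intro x
    obtain ⟨k, l, g, h⟩ := hv (v.symm x)
    have := h.symm
    rw [Homeomorph.apply_symm_apply] at this
    exact ⟨_, _, _, this⟩

theorem LocAt.rigid (hn : 2 ≤ n) {v : Cantor n → Cantor n} {x : Cantor n} {k l : ℕ}
    {g : Equiv.Perm (Fin n)} (hv : LocAt v x k l g) {W : Set (Cantor n)} (hW : IsOpen W)
    {y0 : Cantor n} (hy0 : y0 ∈ W) (hy0x : ∀ i < k, y0 i = x i) (hfix : ∀ y ∈ W, v y = y) :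
    k = l ∧ ∀ y : Cantor n, (∀ i < k, y i = x i) → v y = y := by
  obtain ⟨m, hm⟩ := exists_cone hW hy0
  have : Nontrivial (Fin n) := Fin.nontrivial_iff_two_le.2 hn
  have key : ∀ y : Cantor n, (∀ i < m + k, y i = y0 i) → ∀ i, y (l + i) = g (y (k + i)) := by
    intro y hy i
    have h1 := (hv y (fun i hi => by rw [hy i (by omega), hy0x i hi])).2 i
    rwa [hfix y (hm y fun i hi => hy i (by omega))] at h1
  have hkl : k = l := by
    by_contra hkl
    obtain ⟨c, hc⟩ := exists_ne (g (y0 (k + (m + k))))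
    by_cases hlt : k < l
    · have := key (Function.update y0 (l + (m + k)) c) (fun i hi => by
        rw [Function.update_of_ne (by omega)]) (m + k)
      rw [Function.update_self, Function.update_of_ne (by omega)] at this
      exact hc this
    · obtain ⟨c, hc⟩ := exists_ne (g⁻¹ (y0 (l + (m + k))))
      have := key (Function.update y0 (k + (m + k)) c) (fun i hi => by
        rw [Function.update_of_ne (by omega)]) (m + k)
      rw [Function.update_self, Function.update_of_ne (by omega)] at this
      exact hc (by rw [this]; simp)
  refine ⟨hkl, ?_⟩
  subst hkl
  have hg : ∀ c, g c = c := by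
    intro c
    have := key (Function.update y0 (k + (m + k)) c) (fun i hi => by
        rw [Function.update_of_ne (by omega)]) (m + k)
    rw [Function.update_self] at this
    exact this.symm
  intro y hy
  obtain ⟨h1, h2⟩ := hv y hy
  obtain ⟨h3, -⟩ := hv y0 hy0x
  funext j
  by_cases hj : j < k
  · rw [h1 j hj, ← h3 j hj, hfix y0 hy0, hy0x j hj, hy j hj]
  · obtain ⟨i, rfl⟩ : ∃ i, j = k + i := ⟨j - k, by omega⟩
    rw [h2, hg]

theorem goodGroup_ht (hn : 2 ≤ n) : GoodGroup (HigmanThompson n) := by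
  have hR : Rich (Cantor n) (HigmanThompson n) := rich_of_le hn _ le_rfl
  intro u hu
  have hloc : ∀ x : Cantor n, ∃ M : ℕ,
      (∀ y : Cantor n, (∀ i < M, y i = x i) → u • y = y) ∨
      (∀ y : Cantor n, (∀ i < M, y i = x i) → ¬ ∀ i < M, (u • y) i = x i) := by
    intro x
    by_cases hx : u • x = x
    · obtain ⟨k, l, h⟩ := locAt_ht u.2 x
      obtain ⟨m, hm0, hm⟩ := hu.exists_pow_eq_one
      have hp : ∀ m : ℕ, LocAt (fun y => u ^ m • y) x (m * k) (m * l) 1 ∧ u ^ m • x = x := by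
        intro m
        induction m with
        | zero => exact ⟨fun y _ => ⟨by simp, fun i => by simp⟩, by simp⟩
        | succ m ih =>
          constructor
          · have h' : LocAt (fun y => u • y) (u ^ m • x) k l 1 := by rw [ih.2]; exact h
            have := ih.1.comp h'
            rw [Nat.succ_mul, Nat.succ_mul]
            have e : (fun y : Cantor n => u ^ (m + 1) • y) =
              (fun y => u • y) ∘ (fun y => u ^ m • y) := by
              funext y; simp only [Function.comp]; rw [pow_succ', mul_smul]
            rw [e]
            simpa using this
          · rw [pow_succ', mul_smul, ih.2, hx]
      have hkl := ((hp m).1.rigid hn isOpen_univ (Set.mem_univ x) (fun _ _ => rfl) (by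
        intro y _; simp [hm])).1
      have hkl : k = l := Nat.eq_of_mul_eq_mul_left hm0 hkl
      subst hkl
      refine ⟨k, Or.inl fun y hy => ?_⟩
      obtain ⟨h1, h2⟩ := h y hy
      funext j
      by_cases hj : j < k
      · rw [hy j hj]
        refine (h1 j hj).trans ?_
        exact congrFun hx j
      · obtain ⟨i, rfl⟩ : ∃ i, j = k + i := ⟨j - k, by omega⟩
        exact h2 i
    · obtain ⟨U, hU, hxU, hm⟩ := exists_moved_nhd u x hx
      obtain ⟨M, hM⟩ := exists_cone hU hxU
      exact ⟨M, Or.inr fun y hy hy' => hm y (hM y hy) (hM _ hy')⟩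
  choose M hM using hloc
  choose s hs1 hs2 using fun x : Cantor n => exists_rot hn x (M x)
  obtain ⟨T, hT⟩ := isCompact_univ.elim_finite_subcover
    (fun x : Cantor n => {y : Cantor n | ∀ i < M x, y i = x i}) (fun x => isOpen_cone x (M x))
    (fun x _ => Set.mem_iUnion.2 ⟨x, fun _ _ => rfl⟩)
  refine ⟨s '' T, T.finite_toSet.image s, ?_, ?_⟩
  · rintro _ ⟨x, -, rfl⟩
    rcases hM x with h | h
    · right
      refine algDisj_of_disj hR fun y => ?_
      by_cases hy : ∀ i < M x, y i = x i
      · exact Or.inl (h y hy)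
      · exact Or.inr (hs1 x y hy)
    · left
      refine algDisj_of_disj hR fun y => ?_
      by_cases hy : ∀ i < M x, y i = x i
      · right
        have : ¬ ∀ i < M x, (u⁻¹ • y) i = x i := by
          intro h'
          apply h _ h'
          rwa [smul_inv_smul]
        rw [mul_smul, mul_smul, hs1 x _ this, smul_inv_smul]
      · exact Or.inl (hs1 x y hy)
  · intro h hh
    refine FaithfulSMul.eq_of_smul_eq_smul (α := Cantor n) fun y => ?_
    rw [one_smul]
    obtain ⟨x, hxT, hy⟩ := Set.mem_iUnion₂.1 (hT (Set.mem_univ y))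
    exact (disj_of_algDisj hR (hh _ ⟨x, hxT, rfl⟩) y).resolve_right (hs2 x y hy)

/-- The homeomorphism `[∅]_g`. -/
def letterHomeo (g : Equiv.Perm (Fin n)) : Cantor n ≃ₜ Cantor n where
  toFun x i := g (x i)
  invFun x i := g⁻¹ (x i)
  left_inv x := by funext i; simp
  right_inv x := by funext i; simp
  continuous_toFun := continuous_pi fun i =>
    (continuous_of_discreteTopology (f := g)).comp (continuous_apply i)
  continuous_invFun := continuous_pi fun i =>
    (continuous_of_discreteTopology (f := ⇑g⁻¹)).comp (continuous_apply i)

theorem letterHomeo_mem {G : Subgroup (Equiv.Perm (Fin n))} {g : Equiv.Perm (Fin n)}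
    (hg : g ∈ G) : letterHomeo g ∈ VnG n G := by
  refine Subgroup.subset_closure (Or.inr ⟨[], g, hg, ?_⟩)
  funext x i
  simp [iterPermFun, inCone, letterHomeo]

theorem not_goodGroup (hn : 2 ≤ n) {G : Subgroup (Equiv.Perm (Fin n))} {g : Equiv.Perm (Fin n)}
    (hg : g ∈ G) {a : Fin n} (ha : g a = a) (hg1 : g ≠ 1) : ¬ GoodGroup (VnG n G) := by
  intro H
  have hR : Rich (Cantor n) (VnG n G) :=
    rich_of_le hn _ (Subgroup.closure_mono Set.subset_union_left)
  obtain ⟨u, hu⟩ : ∃ u : VnG n G, ∀ y : Cantor n, u • y = fun i => g (y i) :=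
    ⟨⟨_, letterHomeo_mem hg⟩, fun y => rfl⟩
  have hpow : ∀ (m : ℕ) (y : Cantor n), u ^ m • y = fun i => (g ^ m) (y i) := by
    intro m y
    induction m with
    | zero => simp
    | succ m ih =>
      rw [pow_succ', mul_smul, ih, hu, pow_succ']
      rfl
  have hfin : IsOfFinOrder u := by
    obtain ⟨m, hm0, hm⟩ := (isOfFinOrder_of_finite g).exists_pow_eq_one
    refine isOfFinOrder_iff_pow_eq_one.2 ⟨m, hm0, ?_⟩
    refine FaithfulSMul.eq_of_smul_eq_smul (α := Cantor n) fun y => ?_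
    rw [hpow, hm, one_smul]
    rfl
  obtain ⟨S, hS, hS1, hS2⟩ := H u hfin
  obtain ⟨b, hb⟩ : ∃ b, g b ≠ b := by
    by_contra hc
    push Not at hc
    exact hg1 (Equiv.ext hc)
  let x : Cantor n := fun _ => a
  have hloc : ∀ s ∈ S, ∃ k : ℕ, ∀ y : Cantor n, (∀ i < k, y i = x i) → s ^ 12 • y = y := by
    intro s hs
    rcases hS1 s hs with h | h
    · have h0 := disj_of_algDisj hR (X := Cantor n) h
      have hstep : ∀ y : Cantor n, s ^ 12 • y = y ∨ s ^ 12 • (u⁻¹ • y) = u⁻¹ • y := by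
        intro y
        rcases h0 y with h1 | h1
        · left
          have : ∀ m : ℕ, s ^ m • y = y := by
            intro m
            induction m with
            | zero => simp
            | succ m ih => rw [pow_succ, mul_smul, h1, ih]
          exact this 12
        · right
          rw [conj_pow, mul_smul, mul_smul] at h1
          rw [eq_inv_smul_iff]
          exact h1
      obtain ⟨k, l, c, hL⟩ := locAt_vnG (s ^ 12).2 x
      refine ⟨k, ?_⟩
      by_contra hc
      push Not at hc
      obtain ⟨y1, hy1, hy1'⟩ := hc
      have hO : IsOpen {y : Cantor n | (∀ i < k, (u • y) i = x i) ∧ s ^ 12 • (u • y) ≠ u • y} := by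
        refine IsOpen.inter ?_ ?_
        · exact (isOpen_cone x k).preimage (continuous_const_smul u)
        · exact isOpen_ne_fun ((continuous_const_smul (s ^ 12)).comp (continuous_const_smul u))
            (continuous_const_smul u)
      have hr := (hL.rigid hn hO (y0 := u⁻¹ • y1) (by
          constructor
          · rwa [smul_inv_smul]
          · rwa [smul_inv_smul]) (by
          intro i hi
          have h1 : (u • (u⁻¹ • y1)) i = a := by rw [smul_inv_smul]; exact hy1 i hi
          rw [hu] at h1
          exact g.injective (h1.trans ha.symm)) (by
          rintro y ⟨-, hy⟩
          have := (hstep (u • y)).resolve_left hy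
          rwa [inv_smul_smul] at this)).2
      exact hy1' (hr y1 hy1)
    · have h0 := disj_of_algDisj hR (X := Cantor n) h
      refine ⟨0, fun y _ => ?_⟩
      by_contra hc
      have hO : IsOpen {y : Cantor n | s ^ 12 • y ≠ y} :=
        isOpen_ne_fun (continuous_const_smul (s ^ 12)) continuous_id
      obtain ⟨M, hM⟩ := exists_cone hO (x := y) hc
      have h1 := hM (Function.update y M b) (fun i hi => by
        rw [Function.update_of_ne (by omega)])
      have h2 := (h0 _).resolve_right h1
      have h3 := congrFun h2 M
      rw [hu] at h3
      simp only [Function.update_self] at h3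
      exact hb h3
  obtain ⟨N, hN⟩ : ∃ N : ℕ, ∀ s ∈ S, ∀ y : Cantor n, (∀ i < N, y i = x i) → s ^ 12 • y = y := by
    choose! k hk using hloc
    refine ⟨hS.toFinset.sup k, fun s hs y hy => hk s hs y fun i hi => hy i ?_⟩
    exact lt_of_lt_of_le hi (Finset.le_sup (f := k) (hS.mem_toFinset.2 hs))
  obtain ⟨h, h', hh, -, hne⟩ := hR _ (isOpen_cone x N) ⟨x, fun _ _ => rfl⟩
  apply hne
  have : h = 1 := by
    apply hS2
    intro s hs
    refine algDisj_of_disj hR fun y => ?_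
    by_cases hy : ∀ i < N, y i = x i
    · exact Or.inr (hN s hs y hy)
    · exact Or.inl (hh y hy)
  rw [this]; simp

end Concrete

/-- If `V_n(G)` is isomorphic to `V_n` as abstract groups, then
`G` is semiregular. -/
theorem semiregular_of_vnG_iso_vn (n : ℕ) (hn : 2 ≤ n)
    (G : Subgroup (Equiv.Perm (Fin n)))
    (h : Nonempty (VnG n G ≃* HigmanThompson n)) :
    Semiregular G := by
  obtain ⟨e⟩ := h
  rintro g hg ⟨a, ha⟩
  by_contra hg1
  exact not_goodGroup hn hg ha hg1 ((goodGroup_ht hn).map e.symm)
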